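/- arXiv:2510.26945 — 3 statements merged into one kernel-verified Lean document; each statement's English description precedes it below -/
import Mathlib

section
/- Let E₁ and E₂ be finite index sets and c a single shared (enclosed) corner index. For e = 1, 2, let Sₑ be a real matrix indexed over Eₑ ⊕ Unit, hₑ : Eₑ ⊕ Unit → ℝ, and uₑ : Eₑ → ℝ given exterior boundary values. Assume σ := S₁(c,c) + S₂(c,c) ≠ 0 and set w := −σ⁻¹·( S₁(c,E₁)·u₁ + h₁(c) + S₂(c,E₂)·u₂ + h₂(c) ). Define the exterior residuals rₑᴱ := Sₑ(Eₑ,Eₑ)·uₑ + w·Sₑ(Eₑ,c) + hₑ(Eₑ), where Sₑ(Eₑ,c) is the column of Sₑ at the corner index. Then the concatenated exterior residual (r₁ᴱ, r₂ᴱ) on E₁ ⊕ E₂ equals Sᶜᵒʳⁿᵉʳ·(u₁,u₂) + hᶜᵒʳⁿᵉʳ, where Sᶜᵒʳⁿᵉʳ := [[S₁(E₁,E₁), 0],[0, S₂(E₂,E₂)]] − σ⁻¹·[S₁(E₁,c); S₂(E₂,c)]·[S₁(c,E₁), S₂(c,E₂)] (a rank-one update by the outer product of the concatenated corner column and concatenated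 corner row) and hᶜᵒʳⁿᵉʳ := (h₁(E₁), h₂(E₂)) − σ⁻¹·( h₁(c) + h₂(c) )·[S₁(E₁,c); S₂(E₂,c)]. -/
/-- **Corner merge formula (rank-one update).**
With `σ := S₁(c,c) + S₂(c,c) ≠ 0` and the eliminated corner value
`w := −σ⁻¹·( S₁(c,E₁)·u₁ + h₁(c) + S₂(c,E₂)·u₂ + h₂(c) )`, the concatenated
exterior residuals `rₑᴱ := Sₑ(Eₑ,Eₑ)·uₑ + w·Sₑ(Eₑ,c) + hₑ(Eₑ)` satisfy
`(r₁ᴱ, r₂ᴱ) = Sᶜᵒʳⁿᵉʳ·(u₁,u₂) + hᶜᵒʳⁿᵉʳ`, where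
`Sᶜᵒʳⁿᵉʳ = diag(S₁(E₁,E₁), S₂(E₂,E₂)) − σ⁻¹·[S₁(E₁,c); S₂(E₂,c)]·[S₁(c,E₁), S₂(c,E₂)]`
(a rank-one update by the outer product of the concatenated corner column and row)
and `hᶜᵒʳⁿᵉʳ = (h₁(E₁), h₂(E₂)) − σ⁻¹·( h₁(c) + h₂(c) )·[S₁(E₁,c); S₂(E₂,c)]`. -/
theorem corner_merge_formula
    {E₁ E₂ : Type*} [Fintype E₁] [Fintype E₂]
    (S₁ : Matrix (E₁ ⊕ Unit) (E₁ ⊕ Unit) ℝ) (S₂ : Matrix (E₂ ⊕ Unit) (E₂ ⊕ Unit) ℝ)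
    (h₁ : E₁ ⊕ Unit → ℝ) (h₂ : E₂ ⊕ Unit → ℝ)
    (u₁ : E₁ → ℝ) (u₂ : E₂ → ℝ)
    (hσ : S₁ (Sum.inr ()) (Sum.inr ()) + S₂ (Sum.inr ()) (Sum.inr ()) ≠ 0)
    (w : ℝ)
    (hw : w = -(S₁ (Sum.inr ()) (Sum.inr ()) + S₂ (Sum.inr ()) (Sum.inr ()))⁻¹ *
        ((∑ j, S₁ (Sum.inr ()) (Sum.inl j) * u₁ j) + h₁ (Sum.inr ()) +
          (∑ j, S₂ (Sum.inr ()) (Sum.inl j) * u₂ j) + h₂ (Sum.inr ()))) :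
    Sum.elim
        (S₁.toBlocks₁₁.mulVec u₁ + w • (fun i => S₁ (Sum.inl i) (Sum.inr ())) +
          h₁ ∘ Sum.inl)
        (S₂.toBlocks₁₁.mulVec u₂ + w • (fun i => S₂ (Sum.inl i) (Sum.inr ())) +
          h₂ ∘ Sum.inl) =
      (Matrix.fromBlocks S₁.toBlocks₁₁ 0 0 S₂.toBlocks₁₁ -
          (S₁ (Sum.inr ()) (Sum.inr ()) + S₂ (Sum.inr ()) (Sum.inr ()))⁻¹ •
            Matrix.vecMulVec
              (Sum.elim (fun i => S₁ (Sum.inl i) (Sum.inr ()))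
                (fun i => S₂ (Sum.inl i) (Sum.inr ())))
              (Sum.elim (fun j => S₁ (Sum.inr ()) (Sum.inl j))
                (fun j => S₂ (Sum.inr ()) (Sum.inl j)))).mulVec
          (Sum.elim u₁ u₂) +
        (Sum.elim (h₁ ∘ Sum.inl) (h₂ ∘ Sum.inl) -
          ((S₁ (Sum.inr ()) (Sum.inr ()) + S₂ (Sum.inr ()) (Sum.inr ()))⁻¹ *
              (h₁ (Sum.inr ()) + h₂ (Sum.inr ()))) •
            Sum.elim (fun i => S₁ (Sum.inl i) (Sum.inr ()))
              (fun i => S₂ (Sum.inl i) (Sum.inr ()))) := by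
  subst hw
  rw [Matrix.sub_mulVec, Matrix.smul_mulVec, Matrix.vecMulVec_mulVec,
    Matrix.fromBlocks_mulVec]
  ext (i | i) <;> simp [dotProduct] <;> ring
end

section
/- Let E, I, C be finite index sets and let S be a real square matrix indexed over E ⊕ (I ⊕ C), with blocks S(P,Q) for P, Q among E, I, C. Assume S(I,I) is invertible and that T := S(C,C) − S(C,I)·S(I,I)⁻¹·S(I,C) is invertible. Then the combined block S(I∪C, I∪C) (the square block of S on I ⊕ C) is invertible, and the one-shot elimination of I ⊕ C equals the two-stage elimination of first I and then C: S(E,E) − S(E,I∪C)·S(I∪C,I∪C)⁻¹·S(I∪C,E) = Ŝ(E,E) − Ŝ(E,C)·T⁻¹·Ŝ(C,E), where Ŝ denotes the matrix over E ⊕ C obtained by eliminating I, i.e. Ŝ(P,Q) := S(P,Q) − S(P,I)·S(I,I)⁻¹·S(I,Q) for P, Q among E, C (so that in particular Ŝ(C,C) = T). -/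
open Matrix

variable {E I C : Type*}

/-- The `(E,E)` block of a matrix indexed over `E ⊕ (I ⊕ C)`. -/
def blkEE (S : Matrix (E ⊕ (I ⊕ C)) (E ⊕ (I ⊕ C)) ℝ) : Matrix E E ℝ :=
  S.submatrix Sum.inl Sum.inl

/-- The `(E,I)` block. -/
def blkEI (S : Matrix (E ⊕ (I ⊕ C)) (E ⊕ (I ⊕ C)) ℝ) : Matrix E I ℝ :=
  S.submatrix Sum.inl (Sum.inr ∘ Sum.inl)

/-- The `(E,C)` block. -/
def blkEC (S : Matrix (E ⊕ (I ⊕ C)) (E ⊕ (I ⊕ C)) ℝ) : Matrix E C ℝ :=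
  S.submatrix Sum.inl (Sum.inr ∘ Sum.inr)

/-- The `(I,E)` block. -/
def blkIE (S : Matrix (E ⊕ (I ⊕ C)) (E ⊕ (I ⊕ C)) ℝ) : Matrix I E ℝ :=
  S.submatrix (Sum.inr ∘ Sum.inl) Sum.inl

/-- The `(I,I)` block. -/
def blkII (S : Matrix (E ⊕ (I ⊕ C)) (E ⊕ (I ⊕ C)) ℝ) : Matrix I I ℝ :=
  S.submatrix (Sum.inr ∘ Sum.inl) (Sum.inr ∘ Sum.inl)

/-- The `(I,C)` block. -/
def blkIC (S : Matrix (E ⊕ (I ⊕ C)) (E ⊕ (I ⊕ C)) ℝ) : Matrix I C ℝ :=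
  S.submatrix (Sum.inr ∘ Sum.inl) (Sum.inr ∘ Sum.inr)

/-- The `(C,E)` block. -/
def blkCE (S : Matrix (E ⊕ (I ⊕ C)) (E ⊕ (I ⊕ C)) ℝ) : Matrix C E ℝ :=
  S.submatrix (Sum.inr ∘ Sum.inr) Sum.inl

/-- The `(C,I)` block. -/
def blkCI (S : Matrix (E ⊕ (I ⊕ C)) (E ⊕ (I ⊕ C)) ℝ) : Matrix C I ℝ :=
  S.submatrix (Sum.inr ∘ Sum.inr) (Sum.inr ∘ Sum.inl)

/-- The `(C,C)` block. -/
def blkCC (S : Matrix (E ⊕ (I ⊕ C)) (E ⊕ (I ⊕ C)) ℝ) : Matrix C C ℝ :=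
  S.submatrix (Sum.inr ∘ Sum.inr) (Sum.inr ∘ Sum.inr)

/-- Eliminating an invertible two-by-two block matrix from its complement splits into eliminating
its top-left block and then the resulting Schur complement. -/
theorem fromCols_mul_inv_fromBlocks_mul_fromRows {R l m n o : Type*} [CommRing R]
    [Fintype m] [Fintype n] [DecidableEq m] [DecidableEq n]
    (A : Matrix m m R) (B : Matrix m n R) (C : Matrix n m R) (D : Matrix n n R)
    (U : Matrix l m R) (V : Matrix l n R) (X : Matrix m o R) (Y : Matrix n o R)
    (hA : IsUnit A) (hT : IsUnit (D - C * A⁻¹ * B)) :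
    fromCols U V * (fromBlocks A B C D)⁻¹ * fromRows X Y =
      U * A⁻¹ * X +
        (V - U * A⁻¹ * B) * (D - C * A⁻¹ * B)⁻¹ * (Y - C * A⁻¹ * X) := by
  cases hA.nonempty_invertible
  rw [← invOf_eq_nonsing_inv A] at hT ⊢
  cases hT.nonempty_invertible
  let := fromBlocks₁₁Invertible A B C D
  rw [← invOf_eq_nonsing_inv, ← invOf_eq_nonsing_inv, invOf_fromBlocks₁₁_eq,
    fromCols_mul_fromBlocks, fromCols_mul_fromRows]
  simp only [Matrix.mul_add, Matrix.add_mul, Matrix.mul_sub, Matrix.sub_mul, Matrix.mul_neg,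
    Matrix.neg_mul, Matrix.mul_assoc]
  abel

/-- **Quotient property of Schur complements.**
If `S(I,I)` is invertible and `T := S(C,C) − S(C,I)·S(I,I)⁻¹·S(I,C)` is
invertible, then the combined block `S(I∪C, I∪C)` is invertible, and a one-shot
elimination of `I ⊕ C` equals the two-stage elimination of first `I` and then
`C`, where `Ŝ(P,Q) := S(P,Q) − S(P,I)·S(I,I)⁻¹·S(I,Q)` denotes the operator
obtained by eliminating `I` (so that `Ŝ(C,C) = T`). -/
theorem schur_quotient_property
    [Fintype E] [Fintype I] [Fintype C]
    [DecidableEq E] [DecidableEq I] [DecidableEq C]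
    (S : Matrix (E ⊕ (I ⊕ C)) (E ⊕ (I ⊕ C)) ℝ)
    (hII : IsUnit (blkII S))
    (hT : IsUnit (blkCC S - blkCI S * (blkII S)⁻¹ * blkIC S)) :
    IsUnit S.toBlocks₂₂ ∧
      S.toBlocks₁₁ - S.toBlocks₁₂ * (S.toBlocks₂₂)⁻¹ * S.toBlocks₂₁ =
        (blkEE S - blkEI S * (blkII S)⁻¹ * blkIE S) -
          (blkEC S - blkEI S * (blkII S)⁻¹ * blkIC S) *
            (blkCC S - blkCI S * (blkII S)⁻¹ * blkIC S)⁻¹ *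
            (blkCE S - blkCI S * (blkII S)⁻¹ * blkIE S) := by
  have h₂₂ : S.toBlocks₂₂ = fromBlocks (blkII S) (blkIC S) (blkCI S) (blkCC S) :=
    (fromBlocks_toBlocks S.toBlocks₂₂).symm
  have h₁₂ : S.toBlocks₁₂ = fromCols (blkEI S) (blkEC S) :=
    (fromCols_toCols S.toBlocks₁₂).symm
  have h₂₁ : S.toBlocks₂₁ = fromRows (blkIE S) (blkCE S) :=
    (fromRows_toRows S.toBlocks₂₁).symm
  have h₁₁ : S.toBlocks₁₁ = blkEE S := rfl
  rw [h₁₁, h₁₂, h₂₁, h₂₂]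
  refine ⟨?_, ?_⟩
  · cases hII.nonempty_invertible
    rwa [isUnit_fromBlocks_iff_of_invertible₁₁, invOf_eq_nonsing_inv]
  · rw [fromCols_mul_inv_fromBlocks_mul_fromRows _ _ _ _ _ _ _ _ hII hT, sub_add_eq_sub_sub]
end

section
/- Let ι₁, ι₂ (interior index sets), κ_I (shared interface index set), and κ₁, κ₂ (exterior index sets) be finite index sets. For e = 1, 2, let the local stiffness matrix of subdomain e be the block matrix over ιₑ ⊕ (κ_I ⊕ κₑ) with blocks Aₑ (interior–interior, assumed invertible), Bₑ (interior–boundary), Cₑ (boundary–interior), Dₑ (boundary–boundary), and let Sₑ := Dₑ − Cₑ·Aₑ⁻¹·Bₑ be its local Schur complement, a matrix over κ_I ⊕ κₑ. Let K be the assembled global matrix over (ι₁ ⊕ ι₂) ⊕ (κ_I ⊕ (κ₁ ⊕ κ₂)) defined by: interior block diag(A₁, A₂); interior–boundary blocks given by B₁, B₂ placed so that ιₑ couples only to κ_I and κₑ (zero coupling between ι₁ and κ₂ and between ι₂ and κ₁), and analogously for the boundary–interior blocks from C₁, C₂; and boundary block D with D(κ_I,κ_I) = D₁(κ_I,κ_I)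 + D₂(κ_I,κ_I), D(κ_I,κₑ) = Dₑ(κ_I,κₑ), D(κₑ,κ_I) = Dₑ(κₑ,κ_I), D(κₑ,κₑ) = Dₑ(κₑ,κₑ), and D(κ₁,κ₂) = D(κ₂,κ₁) = 0. Then the Schur complement of K eliminating the interiors ι₁ ⊕ ι₂ is the subassembly of the local Schur complements: its blocks are (κ_I,κ_I)-block S₁(κ_I,κ_I) + S₂(κ_I,κ_I), (κ_I,κₑ)-block Sₑ(κ_I,κₑ), (κₑ,κ_I)-block Sₑ(κₑ,κ_I), (κₑ,κₑ)-block Sₑ(κₑ,κₑ), and zero (κ₁,κ₂) and (κ₂,κ₁) blocks. -/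
variable {ι₁ ι₂ κI κ₁ κ₂ : Type*}

/-- Assembly of the two local interior–boundary blocks into the global
interior–boundary block: `ιₑ` couples only to `κ_I` and `κₑ`. -/
def assembleB (B₁ : Matrix ι₁ (κI ⊕ κ₁) ℝ) (B₂ : Matrix ι₂ (κI ⊕ κ₂) ℝ) :
    Matrix (ι₁ ⊕ ι₂) (κI ⊕ (κ₁ ⊕ κ₂)) ℝ :=
  Matrix.of fun p q =>
    match p, q with
    | .inl i, .inl k => B₁ i (.inl k)
    | .inl i, .inr (.inl k) => B₁ i (.inr k)
    | .inl _, .inr (.inr _) => 0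
    | .inr i, .inl k => B₂ i (.inl k)
    | .inr _, .inr (.inl _) => 0
    | .inr i, .inr (.inr k) => B₂ i (.inr k)

/-- Assembly of the two local boundary–interior blocks into the global
boundary–interior block: `ιₑ` couples only to `κ_I` and `κₑ`. -/
def assembleC (C₁ : Matrix (κI ⊕ κ₁) ι₁ ℝ) (C₂ : Matrix (κI ⊕ κ₂) ι₂ ℝ) :
    Matrix (κI ⊕ (κ₁ ⊕ κ₂)) (ι₁ ⊕ ι₂) ℝ :=
  Matrix.of fun q p =>
    match q, p with
    | .inl k, .inl i => C₁ (.inl k) i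
    | .inl k, .inr i => C₂ (.inl k) i
    | .inr (.inl k), .inl i => C₁ (.inr k) i
    | .inr (.inl _), .inr _ => 0
    | .inr (.inr _), .inl _ => 0
    | .inr (.inr k), .inr i => C₂ (.inr k) i

/-- Subassembly of the two local boundary–boundary blocks into the global
boundary block: contributions on the shared interface `κ_I` are summed, the
remaining blocks are placed in their slots, and the cross-subdomain blocks
between `κ₁` and `κ₂` are zero. -/
def assembleD (D₁ : Matrix (κI ⊕ κ₁) (κI ⊕ κ₁) ℝ) (D₂ : Matrix (κI ⊕ κ₂) (κI ⊕ κ₂) ℝ) :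
    Matrix (κI ⊕ (κ₁ ⊕ κ₂)) (κI ⊕ (κ₁ ⊕ κ₂)) ℝ :=
  Matrix.of fun q q' =>
    match q, q' with
    | .inl k, .inl k' => D₁ (.inl k) (.inl k') + D₂ (.inl k) (.inl k')
    | .inl k, .inr (.inl k') => D₁ (.inl k) (.inr k')
    | .inl k, .inr (.inr k') => D₂ (.inl k) (.inr k')
    | .inr (.inl k), .inl k' => D₁ (.inr k) (.inl k')
    | .inr (.inl k), .inr (.inl k') => D₁ (.inr k) (.inr k')
    | .inr (.inl _), .inr (.inr _) => 0
    | .inr (.inr k), .inl k' => D₂ (.inr k) (.inl k')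
    | .inr (.inr _), .inr (.inl _) => 0
    | .inr (.inr k), .inr (.inr k') => D₂ (.inr k) (.inr k')

/-- **Subassembly of Schur complements.**
For the assembled global matrix `K` (interiors block-diagonal, interface
contributions summed, cross-subdomain couplings zero), the Schur complement of
`K` eliminating the interiors `ι₁ ⊕ ι₂` is exactly the subassembly of the two
local Schur complements `Sₑ := Dₑ − Cₑ·Aₑ⁻¹·Bₑ`. -/
theorem subassembly_of_schur_complements
    [Fintype ι₁] [Fintype ι₂] [Fintype κI] [Fintype κ₁] [Fintype κ₂]
    [DecidableEq ι₁] [DecidableEq ι₂]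
    (A₁ : Matrix ι₁ ι₁ ℝ) (B₁ : Matrix ι₁ (κI ⊕ κ₁) ℝ)
    (C₁ : Matrix (κI ⊕ κ₁) ι₁ ℝ) (D₁ : Matrix (κI ⊕ κ₁) (κI ⊕ κ₁) ℝ)
    (A₂ : Matrix ι₂ ι₂ ℝ) (B₂ : Matrix ι₂ (κI ⊕ κ₂) ℝ)
    (C₂ : Matrix (κI ⊕ κ₂) ι₂ ℝ) (D₂ : Matrix (κI ⊕ κ₂) (κI ⊕ κ₂) ℝ)
    (hA₁ : IsUnit A₁) (hA₂ : IsUnit A₂) :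
    assembleD D₁ D₂ -
        assembleC C₁ C₂ * (Matrix.fromBlocks A₁ 0 0 A₂)⁻¹ * assembleB B₁ B₂ =
      assembleD (D₁ - C₁ * A₁⁻¹ * B₁) (D₂ - C₂ * A₂⁻¹ * B₂) := by
  rw [Matrix.inv_fromBlocks_zero₂₁_of_isUnit_iff A₁ 0 A₂ (iff_of_true hA₁ hA₂)]
  ext (k | k | k) (l | l | l) <;>
    simp [assembleB, assembleC, assembleD, Matrix.mul_apply, Fintype.sum_sum_type]
  ring
end
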